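/- Let f, g: C → D be chain maps of finite-dimensional A-module chain complexes and n ∈ ℤ. For every n-dimensional symmetric structure φ on C, the element ((f+g)^% − f^% − g^%)[φ] ∈ Q^n(D) is the class of the symmetric structure on D whose 0-component is f φ_0 g* + T(f φ_0 g*) and whose components in degrees s ≥ 1 are zero. Likewise, for every n-dimensional quadratic structure ψ on C, ((f+g)_% − f_% − g_%)[ψ] ∈ Q_n(D) is the class of the quadratic structure with 0-component f (ψ_0 + Tψ_0) g* and all higher components zero. -/

import Mathlib

noncomputable section
open scoped Classical

/-- The sign `(-1)^k` for `k : ℤ`. -/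
def esign (k : ℤ) : ℤ := (((-1 : ℤˣ) ^ k : ℤˣ) : ℤ)

variable {A : Type} [Ring A] [StarRing A]

/-- The dual of a left `A`-module, made into a left `A`-module using the involution:
`(a • f) x = f x * star a`. -/
abbrev SDual (A : Type) [Ring A] [StarRing A] (M : Type) [AddCommGroup M] [Module A M] : Type :=
  M →ₗ[A] A

section SDualBasics

variable {M N : Type} [AddCommGroup M] [Module A M] [AddCommGroup N] [Module A N]

instance SDual.instSMul : SMul A (SDual A M) where
  smul a f :=
    { toFun := fun x => f x * star a
      map_add' := fun x y => by simp [add_mul]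
      map_smul' := fun c x => by simp [mul_assoc] }

@[simp] theorem SDual.smul_apply (a : A) (f : SDual A M) (x : M) :
    (a • f) x = f x * star a := rfl

instance SDual.instModule : Module A (SDual A M) :=
  Module.ofMinimalAxioms
    (fun a f g => by ext x; simp [add_mul])
    (fun a b f => by ext x; simp [star_add, mul_add])
    (fun a b f => by ext x; simp [star_mul, mul_assoc])
    (fun f => by ext x; simp)

/-- The dual of an `A`-linear map. -/
def sdualMap (f : M →ₗ[A] N) : SDual A N →ₗ[A] SDual A M where
  toFun g := g.comp f
  map_add' g h := rfl
  map_smul' a g := rfl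

@[simp] theorem sdualMap_apply (f : M →ₗ[A] N) (g : SDual A N) (x : M) :
    sdualMap f g x = g (f x) := rfl

/-- The canonical evaluation map `M → M**`, `x ↦ (f ↦ star (f x))`. -/
def sdualEval (A : Type) [Ring A] [StarRing A] (M : Type) [AddCommGroup M] [Module A M] :
    M →ₗ[A] SDual A (SDual A M) where
  toFun x :=
    { toFun := fun f => star (f x)
      map_add' := fun f g => by simp [star_add]
      map_smul' := fun a f => by simp [star_mul] }
  map_add' x y := by ext f; simp [star_add]
  map_smul' a x := by ext f; simp [star_mul]

end SDualBasics

/-- The underlying graded modules of a chain complex. -/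
structure PreCx (A : Type) [Ring A] [StarRing A] : Type 1 where
  Mod : ℤ → Type
  acg : ∀ r, AddCommGroup (Mod r)
  mod : ∀ r, letI := acg r; Module A (Mod r)

attribute [instance] PreCx.acg PreCx.mod

/-- A finite-dimensional chain complex of f.g. projective left `A`-modules,
together with (the automatically satisfied) reflexivity of the double duality map. -/
structure ChainCx (A : Type) [Ring A] [StarRing A] extends PreCx A : Type 1 where
  fg : ∀ r, Module.Finite A (Mod r)
  proj : ∀ r, Module.Projective A (Mod r)
  bdd : ∃ N : ℕ, ∀ r : ℤ, (N : ℤ) < |r| → Subsingleton (Mod r)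
  d : ∀ r, Mod (r + 1) →ₗ[A] Mod r
  dd : ∀ r, (d r).comp (d (r + 1)) = 0
  refl : ∀ r, Function.Bijective (sdualEval A (Mod r))

namespace ChainCx

variable (C : ChainCx A)

/-- Transport along an equality of degrees. -/
def cst : ∀ {r r' : ℤ}, r = r' → (C.Mod r →ₗ[A] C.Mod r')
  | _, _, rfl => LinearMap.id

/-- Transport of duals along an equality of degrees. -/
def dcst {r r' : ℤ} (h : r = r') : SDual A (C.Mod r) →ₗ[A] SDual A (C.Mod r') :=
  sdualMap (C.cst h.symm)

/-- The inverse of the double duality map. -/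
def coev (r : ℤ) : SDual A (SDual A (C.Mod r)) →ₗ[A] C.Mod r :=
  (LinearEquiv.ofBijective (sdualEval A (C.Mod r)) (C.refl r)).symm.toLinearMap

/-- The transposition `T` on maps `C^p → C_q`, using the identification `M** = M`. -/
def T (p q : ℤ) (θ : SDual A (C.Mod p) →ₗ[A] C.Mod q) :
    SDual A (C.Mod q) →ₗ[A] C.Mod p :=
  esign (p * q) • ((C.coev p).comp (sdualMap θ))

/-- The transposition `T` on maps `C_p → C^q`, using the identification `M** = M`. -/
def Tb (p q : ℤ) (θ : C.Mod p →ₗ[A] SDual A (C.Mod q)) :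
    C.Mod q →ₗ[A] SDual A (C.Mod p) :=
  esign (p * q) • ((sdualMap θ).comp (sdualEval A (C.Mod q)))

/-- The dual differential `C^a → C^b` (where `b = a + 1`). -/
def dstarTo {a b : ℤ} (h : b = a + 1) : SDual A (C.Mod a) →ₗ[A] SDual A (C.Mod b) :=
  sdualMap ((C.d a).comp (C.cst h))

end ChainCx

/-- The group of `n`-dimensional symmetric chains `{φ_s : C^{n-r+s} → C_r}`. -/
abbrev SymCh (C : ChainCx A) (n : ℤ) : Type :=
  ∀ (s : ℕ) (r : ℤ), SDual A (C.Mod (n - r + (s : ℤ))) →ₗ[A] C.Mod r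

/-- The group of `n`-dimensional quadratic chains `{ψ_s : C^{n-r-s} → C_r}`. -/
abbrev QuadCh (C : ChainCx A) (n : ℤ) : Type :=
  ∀ (s : ℕ) (r : ℤ), SDual A (C.Mod (n - r - (s : ℤ))) →ₗ[A] C.Mod r

/-- The group of `n`-dimensional hyperquadratic chains `{θ_s : C^{n-r+s} → C_r}, s ∈ ℤ`. -/
abbrev HypCh (C : ChainCx A) (n : ℤ) : Type :=
  ∀ (s : ℤ) (r : ℤ), SDual A (C.Mod (n - r + s)) →ₗ[A] C.Mod r

variable (C : ChainCx A)

/-- Reindexing of symmetric chains along an equality of dimensions. -/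
def symCastDim {n n' : ℤ} (h : n = n') (φ : SymCh C n) : SymCh C n' := fun s r =>
  (φ s r).comp (C.dcst (show n' - r + (s : ℤ) = n - r + (s : ℤ) by rw [h]))

/-- Reindexing of quadratic chains along an equality of dimensions. -/
def quadCastDim {n n' : ℤ} (h : n = n') (ψ : QuadCh C n) : QuadCh C n' := fun s r =>
  (ψ s r).comp (C.dcst (show n' - r - (s : ℤ) = n - r - (s : ℤ) by rw [h]))

/-- Reindexing of hyperquadratic chains along an equality of dimensions. -/
def hypCastDim {n n' : ℤ} (h : n = n') (θ : HypCh C n) : HypCh C n' := fun s r =>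
  (θ s r).comp (C.dcst (show n' - r + s = n - r + s by rw [h]))

/-- The boundary of an `(n+1)`-dimensional symmetric chain:
`(dξ)_s = d ξ_s + (-1)^r ξ_s d* + (-1)^{n+s} (ξ_{s-1} + (-1)^s T ξ_{s-1})`. -/
def symBnd (n : ℤ) (ξ : SymCh C (n + 1)) : SymCh C n
  | s, r =>
    (C.d r).comp ((ξ s (r + 1)).comp
        (C.dcst (show n - r + (s : ℤ) = n + 1 - (r + 1) + (s : ℤ) by ring)))
    + esign r • ((ξ s r).comp
        (C.dstarTo (show n + 1 - r + (s : ℤ) = (n - r + (s : ℤ)) + 1 by ring)))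
    + (match s with
      | 0 => 0
      | (t + 1) =>
        esign (n + 1 + t) • (
          (ξ t r).comp (C.dcst (show n - r + ((t + 1 : ℕ) : ℤ) = n + 1 - r + (t : ℤ) by
            push_cast; ring))
          + esign ((t : ℤ) + 1) •
            ((C.cst (show n + 1 - (n - r + ((t + 1 : ℕ) : ℤ)) + (t : ℤ) = r by push_cast; ring)).comp
              (C.T _ _ (ξ t (n - r + ((t + 1 : ℕ) : ℤ)))))))

/-- The boundary of an `(n+1)`-dimensional quadratic chain:
`(dχ)_s = d χ_s + (-1)^r χ_s d* + (-1)^{n-s} (χ_{s+1} + (-1)^{s+1} T χ_{s+1})`. -/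
def quadBnd (n : ℤ) (χ : QuadCh C (n + 1)) : QuadCh C n := fun s r =>
  (C.d r).comp ((χ s (r + 1)).comp
      (C.dcst (show n - r - (s : ℤ) = n + 1 - (r + 1) - (s : ℤ) by ring)))
  + esign r • ((χ s r).comp
      (C.dstarTo (show n + 1 - r - (s : ℤ) = (n - r - (s : ℤ)) + 1 by ring)))
  + esign (n - s) • (
      (χ (s + 1) r).comp (C.dcst (show n - r - (s : ℤ) = n + 1 - r - ((s + 1 : ℕ) : ℤ) by
        push_cast; ring))
      + esign ((s : ℤ) + 1) •
        ((C.cst (show n + 1 - (n - r - (s : ℤ)) - ((s + 1 : ℕ) : ℤ) = r by push_cast; ring)).comp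
          (C.T _ _ (χ (s + 1) (n - r - (s : ℤ))))))

/-- The boundary of an `(n+1)`-dimensional hyperquadratic chain. -/
def hypBnd (n : ℤ) (ν : HypCh C (n + 1)) : HypCh C n := fun s r =>
  (C.d r).comp ((ν s (r + 1)).comp
      (C.dcst (show n - r + s = n + 1 - (r + 1) + s by ring)))
  + esign r • ((ν s r).comp
      (C.dstarTo (show n + 1 - r + s = (n - r + s) + 1 by ring)))
  + esign (n + s) • (
      (ν (s - 1) r).comp (C.dcst (show n - r + s = n + 1 - r + (s - 1) by ring))
      + esign s •
        ((C.cst (show n + 1 - (n - r + s) + (s - 1) = r by ring)).comp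
          (C.T _ _ (ν (s - 1) (n - r + s)))))

/-- `φ` is an `n`-dimensional symmetric structure on `C`. -/
def IsSymStr (n : ℤ) (φ : SymCh C n) : Prop :=
  symBnd C (n - 1) (symCastDim C (show n = (n - 1) + 1 by ring) φ) = 0

/-- `ψ` is an `n`-dimensional quadratic structure on `C`. -/
def IsQuadStr (n : ℤ) (ψ : QuadCh C n) : Prop :=
  quadBnd C (n - 1) (quadCastDim C (show n = (n - 1) + 1 by ring) ψ) = 0

/-- `θ` is an `n`-dimensional hyperquadratic structure on `C`. -/
def IsHypStr (n : ℤ) (θ : HypCh C n) : Prop :=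
  hypBnd C (n - 1) (hypCastDim C (show n = (n - 1) + 1 by ring) θ) = 0

/-- The subgroup of `n`-dimensional symmetric structures (cycles). -/
def symCycles (n : ℤ) : AddSubgroup (SymCh C n) := AddSubgroup.closure {φ | IsSymStr C n φ}

/-- The subgroup of boundaries of symmetric chains. -/
def symBdrys (n : ℤ) : AddSubgroup (SymCh C n) := AddSubgroup.closure (Set.range (symBnd C n))

/-- The symmetric `Q`-group `Q^n(C)`. -/
def Qsym (n : ℤ) : Type := symCycles C n ⧸ ((symBdrys C n).addSubgroupOf (symCycles C n))

instance (n : ℤ) : AddCommGroup (Qsym C n) :=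
  inferInstanceAs (AddCommGroup (_ ⧸ (_ : AddSubgroup _)))

/-- The class of a symmetric structure in `Q^n(C)`. -/
def mkSym (n : ℤ) (φ : SymCh C n) (h : IsSymStr C n φ) : Qsym C n :=
  QuotientAddGroup.mk ⟨φ, AddSubgroup.subset_closure h⟩

def quadCycles (n : ℤ) : AddSubgroup (QuadCh C n) := AddSubgroup.closure {ψ | IsQuadStr C n ψ}

def quadBdrys (n : ℤ) : AddSubgroup (QuadCh C n) := AddSubgroup.closure (Set.range (quadBnd C n))

/-- The quadratic `Q`-group `Q_n(C)`. -/
def Qquad (n : ℤ) : Type := quadCycles C n ⧸ ((quadBdrys C n).addSubgroupOf (quadCycles C n))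

instance (n : ℤ) : AddCommGroup (Qquad C n) :=
  inferInstanceAs (AddCommGroup (_ ⧸ (_ : AddSubgroup _)))

def mkQuad (n : ℤ) (ψ : QuadCh C n) (h : IsQuadStr C n ψ) : Qquad C n :=
  QuotientAddGroup.mk ⟨ψ, AddSubgroup.subset_closure h⟩

def hypCycles (n : ℤ) : AddSubgroup (HypCh C n) := AddSubgroup.closure {θ | IsHypStr C n θ}

def hypBdrys (n : ℤ) : AddSubgroup (HypCh C n) := AddSubgroup.closure (Set.range (hypBnd C n))

/-- The hyperquadratic `Q`-group `Q̂^n(C)`. -/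
def Qhyp (n : ℤ) : Type := hypCycles C n ⧸ ((hypBdrys C n).addSubgroupOf (hypCycles C n))

instance (n : ℤ) : AddCommGroup (Qhyp C n) :=
  inferInstanceAs (AddCommGroup (_ ⧸ (_ : AddSubgroup _)))

def mkHyp (n : ℤ) (θ : HypCh C n) (h : IsHypStr C n θ) : Qhyp C n :=
  QuotientAddGroup.mk ⟨θ, AddSubgroup.subset_closure h⟩

/-- The symmetrization `(1+T)ψ` of a quadratic chain. -/
def oneTchain (n : ℤ) (ψ : QuadCh C n) : SymCh C n
  | 0, r =>
    (ψ 0 r).comp (C.dcst (show n - r + ((0 : ℕ) : ℤ) = n - r - ((0 : ℕ) : ℤ) by push_cast; ring))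
    + (C.cst (show n - (n - r + ((0 : ℕ) : ℤ)) - ((0 : ℕ) : ℤ) = r by push_cast; ring)).comp
        (C.T _ _ (ψ 0 (n - r + ((0 : ℕ) : ℤ))))
  | (_ + 1), _ => 0

/-- The map `J` from symmetric to hyperquadratic chains. -/
def Jchain (n : ℤ) (φ : SymCh C n) : HypCh C n := fun s r =>
  if h : 0 ≤ s then
    (φ s.toNat r).comp (C.dcst (by rw [Int.toNat_of_nonneg h]))
  else 0

/-- The map `H` from hyperquadratic to quadratic chains, `ψ_s = θ_{-s-1}`. -/
def Hchain (n : ℤ) (θ : HypCh C n) : QuadCh C (n - 1) := fun s r =>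
  (θ (-(s : ℤ) - 1) r).comp
    (C.dcst (show n - 1 - r - (s : ℤ) = n - r + (-(s : ℤ) - 1) by ring))

/-- A chain map of chain complexes over `A`. -/
structure ChainMap (C D : ChainCx A) : Type where
  f : ∀ r, C.Mod r →ₗ[A] D.Mod r
  comm : ∀ r, (f r).comp (C.d r) = (D.d r).comp (f (r + 1))

/-- Chain homotopy of chain maps. -/
def ChainHtpy {C D : ChainCx A} (F G : ChainMap C D) : Prop :=
  ∃ g : ∀ r, C.Mod r →ₗ[A] D.Mod (r + 1),
    ∀ r, F.f (r + 1) - G.f (r + 1) = (D.d (r + 1)).comp (g (r + 1)) + (g r).comp (C.d r)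

/-- The identity chain map. -/
def ChainMap.idCM (C : ChainCx A) : ChainMap C C :=
  ⟨fun _ => LinearMap.id, fun r => by simp⟩

/-- Composition of chain maps. -/
def ChainMap.compCM {C D E : ChainCx A} (G : ChainMap D E) (F : ChainMap C D) : ChainMap C E :=
  ⟨fun r => (G.f r).comp (F.f r), fun r => by
    rw [LinearMap.comp_assoc, F.comm, ← LinearMap.comp_assoc, G.comm, LinearMap.comp_assoc]⟩

/-- Sum of chain maps. -/
def ChainMap.addCM {C D : ChainCx A} (F G : ChainMap C D) : ChainMap C D :=
  ⟨fun r => F.f r + G.f r, fun r => by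
    rw [LinearMap.add_comp, LinearMap.comp_add, F.comm, G.comm]⟩

/-- A chain map is a chain homotopy equivalence. -/
def IsChainEquiv {C D : ChainCx A} (F : ChainMap C D) : Prop :=
  ∃ G : ChainMap D C, ChainHtpy (G.compCM F) (ChainMap.idCM C) ∧
    ChainHtpy (F.compCM G) (ChainMap.idCM D)

/-- The induced map on symmetric chains, `φ_s ↦ f φ_s f*`. -/
def fSym {C D : ChainCx A} (F : ChainMap C D) (n : ℤ) (φ : SymCh C n) : SymCh D n := fun s r =>
  (F.f r).comp ((φ s r).comp (sdualMap (F.f (n - r + (s : ℤ)))))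

/-- The induced map on quadratic chains. -/
def fQuad {C D : ChainCx A} (F : ChainMap C D) (n : ℤ) (ψ : QuadCh C n) : QuadCh D n := fun s r =>
  (F.f r).comp ((ψ s r).comp (sdualMap (F.f (n - r - (s : ℤ)))))

/-- The induced map on hyperquadratic chains. -/
def fHyp {C D : ChainCx A} (F : ChainMap C D) (n : ℤ) (θ : HypCh C n) : HypCh D n := fun s r =>
  (F.f r).comp ((θ s r).comp (sdualMap (F.f (n - r + s))))

section ErrTerms

variable {C D : ChainCx A} (f g : ChainMap C D) (n : ℤ)

/-- The symmetric error term: `0`-component `f φ₀ g* + T(f φ₀ g*)`, higher components `0`. -/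
def errSym (φ : SymCh C n) : SymCh D n
  | 0, r =>
    (f.f r).comp ((φ 0 r).comp (sdualMap (g.f (n - r + ((0 : ℕ) : ℤ)))))
    + (D.cst (show n - (n - r + ((0 : ℕ) : ℤ)) + ((0 : ℕ) : ℤ) = r by push_cast; ring)).comp
        (D.T _ _ ((f.f (n - r + ((0 : ℕ) : ℤ))).comp
          ((φ 0 (n - r + ((0 : ℕ) : ℤ))).comp
            (sdualMap (g.f (n - (n - r + ((0 : ℕ) : ℤ)) + ((0 : ℕ) : ℤ)))))))
  | (_ + 1), _ => 0

/-- The quadratic error term: `0`-component `f (ψ₀ + Tψ₀) g*`, higher components `0`. -/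
def errQuad (ψ : QuadCh C n) : QuadCh D n
  | 0, r =>
    (f.f r).comp
      (((ψ 0 r)
        + (C.cst (show n - (n - r - ((0 : ℕ) : ℤ)) - ((0 : ℕ) : ℤ) = r by push_cast; ring)).comp
            (C.T _ _ (ψ 0 (n - r - ((0 : ℕ) : ℤ))))).comp
        (sdualMap (g.f (n - r - ((0 : ℕ) : ℤ)))))
  | (_ + 1), _ => 0

end ErrTerms

theorem esign_eq_or (k : ℤ) : esign k = 1 ∨ esign k = -1 := by
  rcases Int.units_eq_one_or ((-1 : ℤˣ) ^ k) with h | h <;> simp [esign, h]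

theorem esign_natCast (s : ℕ) : esign (s : ℤ) = (-1) ^ s := by
  simp [esign]

theorem esign_add (k l : ℤ) : esign (k + l) = esign k * esign l := by
  simp [esign, zpow_add]

theorem esign_neg (k : ℤ) : esign (-k) = esign k := by
  simp [esign]

theorem esign_sub (k l : ℤ) : esign (k - l) = esign k * esign l := by
  rw [sub_eq_add_neg, esign_add, esign_neg]

theorem esign_one : esign 1 = -1 := by
  simp [esign]

namespace ChainCx

@[simp] theorem dcst_rfl (C : ChainCx A) {r : ℤ} (h : r = r) : C.dcst h = LinearMap.id := rfl

theorem dcst_comp_sdualMap {C D : ChainCx A} (F : ChainMap C D) {p q : ℤ} (h : p = q) :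
    (sdualMap (F.f q)).comp (D.dcst h) = (C.dcst h).comp (sdualMap (F.f p)) := by
  subst h; rfl

/-- Transposition commutes with transport of the source degree. -/
theorem cst_comp_T (C : ChainCx A) {p p' : ℤ} (q : ℤ) (h : p' = p)
    (θ : SDual A (C.Mod p') →ₗ[A] C.Mod q) :
    (C.cst h).comp (C.T p' q θ) = C.T p q (θ.comp (C.dcst h.symm)) := by
  subst h; rfl

theorem T_add (C : ChainCx A) (p q : ℤ) (θ η : SDual A (C.Mod p) →ₗ[A] C.Mod q) :
    C.T p q (θ + η) = C.T p q θ + C.T p q η := by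
  have h : sdualMap (θ + η) = sdualMap θ + sdualMap η := by ext x y; simp
  rw [T, h, LinearMap.comp_add, smul_add]; rfl

theorem T_smul (C : ChainCx A) (p q k : ℤ) (θ : SDual A (C.Mod p) →ₗ[A] C.Mod q) :
    C.T p q (k • θ) = k • C.T p q θ :=
  (AddMonoidHom.mk' (C.T p q) (C.T_add p q)).map_zsmul k θ

theorem sdualEval_coev (C : ChainCx A) (r : ℤ) (x : SDual A (SDual A (C.Mod r))) :
    sdualEval A (C.Mod r) (C.coev r x) = x :=
  LinearEquiv.apply_symm_apply (LinearEquiv.ofBijective _ (C.refl r)) x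

theorem coev_comp_sdualMap_sdualMap {C D : ChainCx A} {r : ℤ} (F : C.Mod r →ₗ[A] D.Mod r) :
    (D.coev r).comp (sdualMap (sdualMap F)) = F.comp (C.coev r) := by
  ext x
  apply (D.refl r).1
  obtain ⟨y, rfl⟩ := (C.refl r).2 x
  have h : C.coev r (sdualEval A _ y) = y := (C.refl r).1 (C.sdualEval_coev r _)
  simp only [LinearMap.comp_apply, sdualEval_coev, h]
  rfl

theorem T_comp_comp_sdualMap {C D : ChainCx A} {p q : ℤ} (F : C.Mod q →ₗ[A] D.Mod q)
    (G : C.Mod p →ₗ[A] D.Mod p) (θ : SDual A (C.Mod p) →ₗ[A] C.Mod q) :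
    D.T p q (F.comp (θ.comp (sdualMap G))) = G.comp ((C.T p q θ).comp (sdualMap F)) := by
  have h : sdualMap (F.comp (θ.comp (sdualMap G))) =
      (sdualMap (sdualMap G)).comp ((sdualMap θ).comp (sdualMap F)) := rfl
  rw [T, h, ← LinearMap.comp_assoc, coev_comp_sdualMap_sdualMap, T, LinearMap.smul_comp]
  ext x
  simp

end ChainCx

/-- The component `C^p → C_r` of a symmetric chain, for any `p` with `p + r = n + s`. -/
def SymCh.comp {C : ChainCx A} {n : ℤ} (φ : SymCh C n) (s : ℕ) (p r : ℤ) (h : p + r = n + s) :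
    SDual A (C.Mod p) →ₗ[A] C.Mod r :=
  (φ s r).comp (C.dcst (show p = n - r + (s : ℤ) by linarith))

/-- The component `C^p → C_r` of a quadratic chain, for any `p` with `p + r = n - s`. -/
def QuadCh.comp {C : ChainCx A} {n : ℤ} (ψ : QuadCh C n) (s : ℕ) (p r : ℤ) (h : p + r = n - s) :
    SDual A (C.Mod p) →ₗ[A] C.Mod r :=
  (ψ s r).comp (C.dcst (show p = n - r - (s : ℤ) by linarith))

namespace SymCh

variable {C D : ChainCx A} {n : ℤ}

theorem ext_comp {φ φ' : SymCh C n} (H : ∀ s p r h, comp φ s p r h = comp φ' s p r h) :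
    φ = φ' := by
  funext s r
  exact H s (n - r + s) r (by ring)

theorem comp_symCastDim {n' : ℤ} (e : n = n') (φ : SymCh C n) (s : ℕ) (p r : ℤ)
    (h : p + r = n' + s) : comp (symCastDim C e φ) s p r h = comp φ s p r (by rw [h, e]) := by
  subst e; rfl

theorem comp_symBnd_zero (ξ : SymCh C (n + 1)) (p r : ℤ) (h : p + r = n + (0 : ℕ)) :
    comp (symBnd C n ξ) 0 p r h =
      (C.d r).comp (comp ξ 0 p (r + 1) (by linarith))
      + esign r • (comp ξ 0 (p + 1) r (by linarith)).comp (sdualMap (C.d p)) := by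
  obtain rfl : p = n - r + (0 : ℕ) := by linarith
  simp only [comp, symBnd, ChainCx.dcst_rfl, LinearMap.comp_id, add_zero]
  rfl

theorem comp_symBnd_succ (ξ : SymCh C (n + 1)) (t : ℕ) (p r : ℤ)
    (h : p + r = n + (t + 1 : ℕ)) :
    comp (symBnd C n ξ) (t + 1) p r h =
      (C.d r).comp (comp ξ (t + 1) p (r + 1) (by linarith))
      + esign r • (comp ξ (t + 1) (p + 1) r (by linarith)).comp (sdualMap (C.d p))
      + esign (n + 1 + t) • (comp ξ t p r (by push_cast at h; linarith)
        + esign (t + 1) • C.T r p (comp ξ t r p (by push_cast at h; linarith))) := by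
  obtain rfl : p = n - r + (t + 1 : ℕ) := by linarith
  simp only [comp, symBnd, ChainCx.dcst_rfl, LinearMap.comp_id, ChainCx.cst_comp_T]
  rfl

theorem comp_fSym (F : ChainMap C D) (φ : SymCh C n) (s : ℕ) (p r : ℤ) (h : p + r = n + s) :
    comp (fSym F n φ) s p r h = (F.f r).comp ((comp φ s p r h).comp (sdualMap (F.f p))) := by
  obtain rfl : p = n - r + s := by linarith
  rfl

theorem comp_errSym_zero (F G : ChainMap C D) (φ : SymCh C n) (p r : ℤ)
    (h : p + r = n + (0 : ℕ)) :
    comp (errSym F G n φ) 0 p r h =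
      (F.f r).comp ((comp φ 0 p r h).comp (sdualMap (G.f p)))
      + D.T r p ((F.f p).comp ((comp φ 0 r p (by linarith)).comp (sdualMap (G.f r)))) := by
  obtain rfl : p = n - r + (0 : ℕ) := by linarith
  simp only [comp, errSym, ChainCx.dcst_rfl, LinearMap.comp_id, ChainCx.cst_comp_T,
    LinearMap.comp_assoc, ChainCx.dcst_comp_sdualMap]

/-- The cycle relation, composed with `F` on the left and `G*` on the right. -/
theorem _root_.IsSymStr.sandwich {φ : SymCh C n} (hφ : IsSymStr C n φ) (F G : ChainMap C D)
    (s : ℕ) (p r : ℤ) (h : p + r = n + s) :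
    (D.d r).comp ((F.f (r + 1)).comp ((comp φ (s + 1) p (r + 1) (by push_cast; linarith)).comp
        (sdualMap (G.f p))))
      + esign r • ((F.f r).comp ((comp φ (s + 1) (p + 1) r (by push_cast; linarith)).comp
        (sdualMap (G.f (p + 1))))).comp (sdualMap (D.d p))
      + esign (n + s) • ((F.f r).comp ((comp φ s p r h).comp (sdualMap (G.f p)))
        + esign (s + 1) • (F.f r).comp
          ((C.T r p (comp φ s r p (by linarith))).comp (sdualMap (G.f p)))) = 0 := by
  have H := congrArg (fun ω => comp ω (s + 1) p r (by push_cast; linarith)) hφ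
  simp only [comp_symBnd_succ, comp_symCastDim, sub_add_cancel] at H
  have hG : (sdualMap (G.f (p + 1))).comp (sdualMap (D.d p)) =
      (sdualMap (C.d p)).comp (sdualMap (G.f p)) := by
    change sdualMap ((D.d p).comp (G.f (p + 1))) = sdualMap ((G.f p).comp (C.d p))
    rw [G.comm]
  have K := congrArg (fun θ => (F.f r).comp (θ.comp (sdualMap (G.f p)))) H
  simp only [LinearMap.comp_assoc, hG]
  rw [← LinearMap.comp_assoc, ← F.comm]
  ext x
  have Kx := LinearMap.congr_fun K x
  simpa [comp, SymCh] using Kx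

/-- The chain `± g φ_{s+1} f*` (`s` even), `± f φ_{s+1} g*` (`s` odd), whose boundary measures the
failure of additivity of `f ↦ f^%` up to the error term. -/
def additivityHtpy (f g : ChainMap C D) (φ : SymCh C n) : SymCh D (n + 1) := fun s r =>
  esign (n + s + 1) • if Even s then
      (g.f r).comp ((comp φ (s + 1) (n + 1 - r + s) r (by push_cast; ring)).comp
        (sdualMap (f.f (n + 1 - r + s))))
    else
      (f.f r).comp ((comp φ (s + 1) (n + 1 - r + s) r (by push_cast; ring)).comp
        (sdualMap (g.f (n + 1 - r + s))))

theorem comp_additivityHtpy (f g : ChainMap C D) (φ : SymCh C n) (s : ℕ) (p r : ℤ)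
    (h : p + r = n + 1 + s) :
    comp (additivityHtpy f g φ) s p r h =
      esign (n + s + 1) • if Even s then
        (g.f r).comp ((comp φ (s + 1) p r (by push_cast; linarith)).comp (sdualMap (f.f p)))
      else
        (f.f r).comp ((comp φ (s + 1) p r (by push_cast; linarith)).comp (sdualMap (g.f p))) := by
  obtain rfl : p = n + 1 - r + s := by linarith
  rfl

theorem comp_fSym_addCM (f g : ChainMap C D) (φ : SymCh C n) (s : ℕ) (p r : ℤ)
    (h : p + r = n + s) :
    comp (fSym (f.addCM g) n φ - fSym f n φ - fSym g n φ) s p r h =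
      (f.f r).comp ((comp φ s p r h).comp (sdualMap (g.f p)))
      + (g.f r).comp ((comp φ s p r h).comp (sdualMap (f.f p))) := by
  have e : comp (fSym (f.addCM g) n φ - fSym f n φ - fSym g n φ) s p r h =
    comp (fSym (f.addCM g) n φ) s p r h - comp (fSym f n φ) s p r h
      - comp (fSym g n φ) s p r h := rfl
  have e' : sdualMap ((f.addCM g).f p) = sdualMap (f.f p) + sdualMap (g.f p) := by
    ext x y; exact map_add x _ _
  rw [e, comp_fSym, comp_fSym, comp_fSym, e']
  simp only [ChainMap.addCM, LinearMap.comp_add, LinearMap.add_comp]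
  abel

theorem fSym_addCM_sub_sub (f g : ChainMap C D) {φ : SymCh C n} (hφ : IsSymStr C n φ) :
    fSym (f.addCM g) n φ - fSym f n φ - fSym g n φ =
      errSym f g n φ + symBnd D n (additivityHtpy f g φ) := by
  refine ext_comp fun s p r h => ?_
  have e : comp (errSym f g n φ + symBnd D n (additivityHtpy f g φ)) s p r h =
    comp (errSym f g n φ) s p r h + comp (symBnd D n (additivityHtpy f g φ)) s p r h := rfl
  rw [comp_fSym_addCM, e]
  have Hgf := hφ.sandwich g f s p r h
  have Hfg := hφ.sandwich f g s p r h
  cases s with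
  | zero =>
    rw [comp_errSym_zero, comp_symBnd_zero, comp_additivityHtpy, comp_additivityHtpy,
      ChainCx.T_comp_comp_sdualMap]
    simp only [Nat.cast_zero, add_zero, zero_add, esign_add, esign_one, Even.zero, if_true,
      LinearMap.comp_smul, LinearMap.smul_comp] at *
    rcases esign_eq_or n with hn | hn <;> rw [hn] at Hgf ⊢
    · linear_combination (norm := module) Hgf
    · linear_combination (norm := module) (-1 : ℤ) • Hgf
  | succ t =>
    have e0 : comp (errSym f g n φ) (t + 1) p r h = 0 := rfl
    rw [e0, comp_symBnd_succ]
    simp only [comp_additivityHtpy, ChainCx.T_smul]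
    rcases Nat.even_or_odd t with ht | ht
    · have ht' : ¬ Even (t + 1) := by simpa [Nat.even_add_one] using ht
      simp only [ht, ht', if_true, if_false, ChainCx.T_comp_comp_sdualMap, Nat.cast_add,
        Nat.cast_one, esign_add, esign_one, esign_natCast, ht.neg_one_pow,
        LinearMap.comp_smul, LinearMap.smul_comp] at *
      rcases esign_eq_or n with hn | hn <;> rw [hn] at Hfg ⊢
      · linear_combination (norm := module) (-1 : ℤ) • Hfg
      · linear_combination (norm := module) Hfg
    · have ht' : Even (t + 1) := ht.add_one
      have ht'' : ¬ Even t := by simpa using ht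
      simp only [ht', ht'', if_true, if_false, ChainCx.T_comp_comp_sdualMap, Nat.cast_add,
        Nat.cast_one, esign_add, esign_one, esign_natCast, ht.neg_one_pow,
        LinearMap.comp_smul, LinearMap.smul_comp] at *
      rcases esign_eq_or n with hn | hn <;> rw [hn] at Hgf ⊢
      · linear_combination (norm := module) Hgf
      · linear_combination (norm := module) (-1 : ℤ) • Hgf

end SymCh

namespace QuadCh

variable {C D : ChainCx A} {n : ℤ}

theorem ext_comp {ψ ψ' : QuadCh C n} (H : ∀ s p r h, comp ψ s p r h = comp ψ' s p r h) :
    ψ = ψ' := by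
  funext s r
  exact H s (n - r - s) r (by ring)

theorem comp_quadCastDim {n' : ℤ} (e : n = n') (ψ : QuadCh C n) (s : ℕ) (p r : ℤ)
    (h : p + r = n' - s) : comp (quadCastDim C e ψ) s p r h = comp ψ s p r (by rw [h, e]) := by
  subst e; rfl

theorem comp_quadBnd (χ : QuadCh C (n + 1)) (s : ℕ) (p r : ℤ) (h : p + r = n - s) :
    comp (quadBnd C n χ) s p r h =
      (C.d r).comp (comp χ s p (r + 1) (by linarith))
      + esign r • (comp χ s (p + 1) r (by linarith)).comp (sdualMap (C.d p))
      + esign (n - s) • (comp χ (s + 1) p r (by push_cast; linarith)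
        + esign (s + 1) • C.T r p (comp χ (s + 1) r p (by push_cast; linarith))) := by
  obtain rfl : p = n - r - s := by linarith
  simp only [comp, quadBnd, ChainCx.dcst_rfl, LinearMap.comp_id, ChainCx.cst_comp_T]
  rfl

theorem comp_fQuad (F : ChainMap C D) (ψ : QuadCh C n) (s : ℕ) (p r : ℤ) (h : p + r = n - s) :
    comp (fQuad F n ψ) s p r h = (F.f r).comp ((comp ψ s p r h).comp (sdualMap (F.f p))) := by
  obtain rfl : p = n - r - s := by linarith
  rfl

theorem comp_errQuad_zero (F G : ChainMap C D) (ψ : QuadCh C n) (p r : ℤ)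
    (h : p + r = n - (0 : ℕ)) :
    comp (errQuad F G n ψ) 0 p r h =
      (F.f r).comp ((comp ψ 0 p r h + C.T r p (comp ψ 0 r p (by linarith))).comp
        (sdualMap (G.f p))) := by
  obtain rfl : p = n - r - (0 : ℕ) := by linarith
  simp only [comp, errQuad, ChainCx.dcst_rfl, LinearMap.comp_id, ChainCx.cst_comp_T]

/-- The cycle relation, composed with `F` on the left and `G*` on the right. -/
theorem _root_.IsQuadStr.sandwich {ψ : QuadCh C n} (hψ : IsQuadStr C n ψ) (F G : ChainMap C D)
    (s : ℕ) (p r : ℤ) (h : p + r = n - (s + 1 : ℕ)) :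
    (D.d r).comp ((F.f (r + 1)).comp ((comp ψ s p (r + 1) (by push_cast at h; linarith)).comp
        (sdualMap (G.f p))))
      + esign r • ((F.f r).comp ((comp ψ s (p + 1) r (by push_cast at h; linarith)).comp
        (sdualMap (G.f (p + 1))))).comp (sdualMap (D.d p))
      + esign (n - 1 - s) • ((F.f r).comp ((comp ψ (s + 1) p r h).comp (sdualMap (G.f p)))
        + esign (s + 1) • (F.f r).comp
          ((C.T r p (comp ψ (s + 1) r p (by linarith))).comp (sdualMap (G.f p)))) = 0 := by
  have H := congrArg (fun ω => comp ω s p r (by push_cast at h; linarith)) hψ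
  simp only [comp_quadBnd, comp_quadCastDim] at H
  have hG : (sdualMap (G.f (p + 1))).comp (sdualMap (D.d p)) =
      (sdualMap (C.d p)).comp (sdualMap (G.f p)) := by
    change sdualMap ((D.d p).comp (G.f (p + 1))) = sdualMap ((G.f p).comp (C.d p))
    rw [G.comm]
  have K := congrArg (fun θ => (F.f r).comp (θ.comp (sdualMap (G.f p)))) H
  simp only [LinearMap.comp_assoc, hG]
  rw [← LinearMap.comp_assoc, ← F.comm]
  ext x
  have Kx := LinearMap.congr_fun K x
  simpa [comp, QuadCh] using Kx

/-- The chain with zero `0`-component and with `(t+1)`-component `± g ψ_t f*` (`t` even),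
`± f ψ_t g*` (`t` odd), whose boundary measures the failure of additivity of `f ↦ f_%` up to
the error term. -/
def additivityHtpy (f g : ChainMap C D) (ψ : QuadCh C n) : QuadCh D (n + 1)
  | 0, _ => 0
  | t + 1, r =>
    esign (n - t) • if Even t then
      (g.f r).comp ((comp ψ t (n + 1 - r - (t + 1 : ℕ)) r (by push_cast; ring)).comp
        (sdualMap (f.f (n + 1 - r - (t + 1 : ℕ)))))
    else
      (f.f r).comp ((comp ψ t (n + 1 - r - (t + 1 : ℕ)) r (by push_cast; ring)).comp
        (sdualMap (g.f (n + 1 - r - (t + 1 : ℕ)))))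

theorem comp_additivityHtpy_zero (f g : ChainMap C D) (ψ : QuadCh C n) (p r : ℤ)
    (h : p + r = n + 1 - (0 : ℕ)) : comp (additivityHtpy f g ψ) 0 p r h = 0 := rfl

theorem comp_additivityHtpy_succ (f g : ChainMap C D) (ψ : QuadCh C n) (t : ℕ) (p r : ℤ)
    (h : p + r = n + 1 - (t + 1 : ℕ)) :
    comp (additivityHtpy f g ψ) (t + 1) p r h =
      esign (n - t) • if Even t then
        (g.f r).comp ((comp ψ t p r (by push_cast at h; linarith)).comp (sdualMap (f.f p)))
      else
        (f.f r).comp ((comp ψ t p r (by push_cast at h; linarith)).comp (sdualMap (g.f p))) := by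
  obtain rfl : p = n + 1 - r - (t + 1 : ℕ) := by linarith
  rfl

theorem comp_fQuad_addCM (f g : ChainMap C D) (ψ : QuadCh C n) (s : ℕ) (p r : ℤ)
    (h : p + r = n - s) :
    comp (fQuad (f.addCM g) n ψ - fQuad f n ψ - fQuad g n ψ) s p r h =
      (f.f r).comp ((comp ψ s p r h).comp (sdualMap (g.f p)))
      + (g.f r).comp ((comp ψ s p r h).comp (sdualMap (f.f p))) := by
  have e : comp (fQuad (f.addCM g) n ψ - fQuad f n ψ - fQuad g n ψ) s p r h =
    comp (fQuad (f.addCM g) n ψ) s p r h - comp (fQuad f n ψ) s p r h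
      - comp (fQuad g n ψ) s p r h := rfl
  have e' : sdualMap ((f.addCM g).f p) = sdualMap (f.f p) + sdualMap (g.f p) := by
    ext x y; exact map_add x _ _
  rw [e, comp_fQuad, comp_fQuad, comp_fQuad, e']
  simp only [ChainMap.addCM, LinearMap.comp_add, LinearMap.add_comp]
  abel

theorem fQuad_addCM_sub_sub (f g : ChainMap C D) {ψ : QuadCh C n} (hψ : IsQuadStr C n ψ) :
    fQuad (f.addCM g) n ψ - fQuad f n ψ - fQuad g n ψ =
      errQuad f g n ψ + quadBnd D n (additivityHtpy f g ψ) := by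
  refine ext_comp fun s p r h => ?_
  have e : comp (errQuad f g n ψ + quadBnd D n (additivityHtpy f g ψ)) s p r h =
    comp (errQuad f g n ψ) s p r h + comp (quadBnd D n (additivityHtpy f g ψ)) s p r h := rfl
  rw [comp_fQuad_addCM, e, comp_quadBnd]
  cases s with
  | zero =>
    rw [comp_errQuad_zero, comp_additivityHtpy_zero, comp_additivityHtpy_zero,
      comp_additivityHtpy_succ, comp_additivityHtpy_succ]
    simp only [Nat.cast_zero, sub_zero, zero_add, esign_one, Even.zero, if_true,
      LinearMap.comp_zero, LinearMap.zero_comp, LinearMap.comp_add, LinearMap.add_comp,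
      ChainCx.T_smul, ChainCx.T_comp_comp_sdualMap]
    rcases esign_eq_or n with hn | hn <;> rw [hn] <;> module
  | succ t =>
    have e0 : comp (errQuad f g n ψ) (t + 1) p r h = 0 := rfl
    have Hgf := hψ.sandwich g f t p r h
    have Hfg := hψ.sandwich f g t p r h
    rw [e0]
    simp only [comp_additivityHtpy_succ, ChainCx.T_smul]
    rcases Nat.even_or_odd t with ht | ht
    · have ht' : ¬ Even (t + 1) := by simpa [Nat.even_add_one] using ht
      simp only [ht, ht', if_true, if_false, ChainCx.T_comp_comp_sdualMap, Nat.cast_add,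
        Nat.cast_one, esign_add, esign_sub, esign_one, esign_natCast, ht.neg_one_pow,
        LinearMap.comp_smul, LinearMap.smul_comp] at *
      rcases esign_eq_or n with hn | hn <;> rw [hn] at Hgf ⊢
      · linear_combination (norm := module) (-1 : ℤ) • Hgf
      · linear_combination (norm := module) Hgf
    · have ht' : Even (t + 1) := ht.add_one
      have ht'' : ¬ Even t := by simpa using ht
      simp only [ht', ht'', if_true, if_false, ChainCx.T_comp_comp_sdualMap, Nat.cast_add,
        Nat.cast_one, esign_add, esign_sub, esign_one, esign_natCast, ht.neg_one_pow,
        LinearMap.comp_smul, LinearMap.smul_comp] at *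
      rcases esign_eq_or n with hn | hn <;> rw [hn] at Hfg ⊢
      · linear_combination (norm := module) Hfg
      · linear_combination (norm := module) (-1 : ℤ) • Hfg

end QuadCh

/-- Let `f, g : C → D` be chain maps and `n : ℤ`.  For every `n`-dimensional
symmetric structure `φ` on `C`, the element `((f+g)^% - f^% - g^%)[φ] ∈ Q^n(D)` is the class
of the symmetric structure on `D` with `0`-component `f φ₀ g* + T(f φ₀ g*)` and vanishing
higher components; likewise for quadratic structures, with error term `f (ψ₀ + Tψ₀) g*`. -/
theorem stmt6 (A : Type) [Ring A] [StarRing A] {C D : ChainCx A}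
    (f g : ChainMap C D) (n : ℤ) :
    (∀ (φ : SymCh C n) (h1 : IsSymStr C n φ)
        (h2 : IsSymStr D n (fSym (f.addCM g) n φ))
        (h3 : IsSymStr D n (fSym f n φ)) (h4 : IsSymStr D n (fSym g n φ))
        (h5 : IsSymStr D n (errSym f g n φ)),
      mkSym D n (fSym (f.addCM g) n φ) h2 - mkSym D n (fSym f n φ) h3 -
          mkSym D n (fSym g n φ) h4 =
        mkSym D n (errSym f g n φ) h5) ∧
    (∀ (ψ : QuadCh C n) (h1 : IsQuadStr C n ψ)
        (h2 : IsQuadStr D n (fQuad (f.addCM g) n ψ))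
        (h3 : IsQuadStr D n (fQuad f n ψ)) (h4 : IsQuadStr D n (fQuad g n ψ))
        (h5 : IsQuadStr D n (errQuad f g n ψ)),
      mkQuad D n (fQuad (f.addCM g) n ψ) h2 - mkQuad D n (fQuad f n ψ) h3 -
          mkQuad D n (fQuad g n ψ) h4 =
        mkQuad D n (errQuad f g n ψ) h5) := by
  constructor
  · intro φ h1 h2 h3 h4 h5
    refine (QuotientAddGroup.eq_iff_sub_mem (N := (symBdrys D n).addSubgroupOf (symCycles D n))).2
      (AddSubgroup.mem_addSubgroupOf.2 (AddSubgroup.subset_closure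
        ⟨SymCh.additivityHtpy f g φ, ?_⟩))
    exact (sub_eq_of_eq_add' (SymCh.fSym_addCM_sub_sub f g h1)).symm
  · intro ψ h1 h2 h3 h4 h5
    refine (QuotientAddGroup.eq_iff_sub_mem
      (N := (quadBdrys D n).addSubgroupOf (quadCycles D n))).2
      (AddSubgroup.mem_addSubgroupOf.2 (AddSubgroup.subset_closure
        ⟨QuadCh.additivityHtpy f g ψ, ?_⟩))
    exact (sub_eq_of_eq_add' (QuadCh.fQuad_addCM_sub_sub f g h1)).symm
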